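/- Elimination of action nominals: let A = (Σ, E, PRE) be an event model with preconditions in L∃U. For every event α ∈ Σ and every sentence ψ of the extended set S∃Uj (built from atoms, the action nominals j_0, …, j_{n−1}, negation, conjunction, □, propositional quantifiers ∃p, and the global modality U), there exists a formula χ ∈ L∃U such that χ ≡ ⟨α⟩ψ is valid, i.e. for every relational model M and point ω: M, ω ⊨ χ if and only if M, ω ⊨ Pre_α and M ⊗ A, (ω, α) ⊨ ψ. -/

import Mathlib

/-- A relational model over a set of worlds `W`. -/
structure Model (W : Type) where
  rel : W → W → Prop
  val : ℕ → Set W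

/-- Change the valuation of the proposition letter `p` to `X`. -/
def Model.update {W : Type} (M : Model W) (p : ℕ) (X : Set W) : Model W :=
  ⟨M.rel, fun q => if q = p then X else M.val q⟩

/-- Restriction (relativisation) of a model to a subset of its domain. -/
def Model.restrict {W : Type} (M : Model W) (A : Set W) : Model A :=
  ⟨fun a b => M.rel a.1 b.1, fun p => {a | a.1 ∈ M.val p}⟩

/-- The language `L∃U`: propositionally quantified modal logic with the global modality. -/
inductive Form : Type where
  | atom : ℕ → Form
  | neg : Form → Form
  | and : Form → Form → Form
  | box : Form → Form
  | ex : ℕ → Form → Form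
  | uni : Form → Form

/-- Satisfaction for `L∃U`. -/
def Sat {W : Type} : Model W → W → Form → Prop
  | M, w, .atom p => w ∈ M.val p
  | M, w, .neg φ => ¬ Sat M w φ
  | M, w, .and φ ψ => Sat M w φ ∧ Sat M w ψ
  | M, w, .box φ => ∀ v, M.rel w v → Sat M v φ
  | M, w, .ex p φ => ∃ X : Set W, Sat (M.update p X) w φ
  | M, w, .uni φ => ∀ v, Sat M v φ

/-- Material implication, `φ ⊃ ψ`. -/
def Form.imp (φ ψ : Form) : Form := .neg (.and φ (.neg ψ))

/-- The proposition letter `p` occurs in a formula. -/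
def Form.Occurs (p : ℕ) : Form → Prop
  | .atom q => q = p
  | .neg φ => φ.Occurs p
  | .and φ ψ => φ.Occurs p ∨ ψ.Occurs p
  | .box φ => φ.Occurs p
  | .ex q φ => q = p ∨ φ.Occurs p
  | .uni φ => φ.Occurs p

/-- The formula contains no global modality `U` (i.e. is in `L∃`). -/
def Form.UFree : Form → Prop
  | .atom _ => True
  | .neg φ => φ.UFree
  | .and φ ψ => φ.UFree ∧ ψ.UFree
  | .box φ => φ.UFree
  | .ex _ φ => φ.UFree
  | .uni _ => False

/-- Semantics of the dynamic relativisation (public announcement) modality `⟨!A⟩φ`. -/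
def SatRel {W : Type} (M : Model W) (w : W) (A φ : Form) : Prop :=
  ∃ h : w ∈ {v | Sat M v A}, Sat (M.restrict {v | Sat M v A}) ⟨w, h⟩ φ

/-- An event model with `n` events `α_0, …, α_{n-1}`, preconditions in `L∃U`. -/
structure EventModel (n : ℕ) where
  E : Fin n → Fin n → Prop
  pre : Fin n → Form

/-- The domain of the product update `M ⊗ A`. -/
def prodDomain {W : Type} (M : Model W) {n : ℕ} (A : EventModel n) : Set (W × Fin n) :=
  {x | Sat M x.1 (A.pre x.2)}

/-- The product update `M ⊗ A`. -/
def prodModel {W : Type} (M : Model W) {n : ℕ} (A : EventModel n) :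
    Model (prodDomain M A) :=
  ⟨fun x y => M.rel x.1.1 y.1.1 ∧ A.E x.1.2 y.1.2, fun p => {x | x.1.1 ∈ M.val p}⟩

/-- Semantics of the action modality `⟨α⟩φ` for `φ ∈ L∃U`. -/
def SatAct {W : Type} {n : ℕ} (M : Model W) (A : EventModel n) (α : Fin n) (w : W)
    (φ : Form) : Prop :=
  ∃ h : (w, α) ∈ prodDomain M A, Sat (prodModel M A) ⟨(w, α), h⟩ φ

/-- The set of sentences `S∃Uj`: `L∃U` plus action nominals `j_i`. -/
inductive FormJ (n : ℕ) : Type where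
  | atom : ℕ → FormJ n
  | nom : Fin n → FormJ n
  | neg : FormJ n → FormJ n
  | and : FormJ n → FormJ n → FormJ n
  | box : FormJ n → FormJ n
  | ex : ℕ → FormJ n → FormJ n
  | uni : FormJ n → FormJ n

/-- Satisfaction for `S∃Uj`, relative to a labelling of worlds by events
(in a product model `M ⊗ A` the label of `(ω, α)` is `α`). -/
def SatJ {n : ℕ} {V : Type} (lab : V → Fin n) : Model V → V → FormJ n → Prop
  | M, w, .atom p => w ∈ M.val p
  | _, w, .nom i => lab w = i
  | M, w, .neg φ => ¬ SatJ lab M w φ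
  | M, w, .and φ ψ => SatJ lab M w φ ∧ SatJ lab M w ψ
  | M, w, .box φ => ∀ v, M.rel w v → SatJ lab M v φ
  | M, w, .ex p φ => ∃ X : Set V, SatJ lab (M.update p X) w φ
  | M, w, .uni φ => ∀ v, SatJ lab M v φ

/-- Semantics of the action modality `⟨α⟩ψ` applied to a sentence `ψ ∈ S∃Uj`:
`M, w ⊨ ⟨α⟩ψ` iff `M, w ⊨ Pre_α` and `M ⊗ A, (w, α) ⊨ ψ`. -/
def SatActJ {W : Type} {n : ℕ} (M : Model W) (A : EventModel n) (α : Fin n) (w : W)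
    (ψ : FormJ n) : Prop :=
  ∃ h : (w, α) ∈ prodDomain M A,
    SatJ (fun x : prodDomain M A => x.1.2) (prodModel M A) ⟨(w, α), h⟩ ψ

/-- The proposition letter `p` occurs in a sentence of `S∃Uj`. -/
def FormJ.Occurs {n : ℕ} (p : ℕ) : FormJ n → Prop
  | .atom q => q = p
  | .nom _ => False
  | .neg φ => φ.Occurs p
  | .and φ ψ => φ.Occurs p ∨ ψ.Occurs p
  | .box φ => φ.Occurs p
  | .ex q φ => q = p ∨ φ.Occurs p
  | .uni φ => φ.Occurs p

/-- Substitution `φ(σ)` of the sentence `σ` for the proposition letter `p` in `φ`. -/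
def FormJ.subst {n : ℕ} (p : ℕ) (σ : FormJ n) : FormJ n → FormJ n
  | .atom q => if q = p then σ else .atom q
  | .nom i => .nom i
  | .neg φ => .neg (FormJ.subst p σ φ)
  | .and φ ψ => .and (FormJ.subst p σ φ) (FormJ.subst p σ ψ)
  | .box φ => .box (FormJ.subst p σ φ)
  | .ex q φ => if q = p then .ex q φ else .ex q (FormJ.subst p σ φ)
  | .uni φ => .uni (FormJ.subst p σ φ)

/-- Disjunction, defined from `¬` and `∧`. -/
def FormJ.or {n : ℕ} (φ ψ : FormJ n) : FormJ n := .neg (.and (.neg φ) (.neg ψ))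

/-- Finite disjunction `⋁`. -/
def FormJ.bigOr {n : ℕ} : List (FormJ n) → FormJ n
  | [] => .and (.atom 0) (.neg (.atom 0))
  | [φ] => φ
  | φ :: ψ :: rest => φ.or (FormJ.bigOr (ψ :: rest))

/-- Simultaneous update of the valuation of the (distinct) letters `ps i` to `X i`. -/
def Model.updateMany {W : Type} (M : Model W) {n : ℕ} (ps : Fin n → ℕ)
    (X : Fin n → Set W) : Model W :=
  ⟨M.rel, fun q => {w | (∃ i, ps i = q ∧ w ∈ X i) ∨ ((∀ i, ps i ≠ q) ∧ w ∈ M.val q)}⟩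

/-- A concrete numerical encoding of `L∃U` formulas. -/
def Form.toNat : Form → ℕ
  | .atom p => Nat.pair 0 p
  | .neg φ => Nat.pair 1 φ.toNat
  | .and φ ψ => Nat.pair 2 (Nat.pair φ.toNat ψ.toNat)
  | .box φ => Nat.pair 3 φ.toNat
  | .ex p φ => Nat.pair 4 (Nat.pair p φ.toNat)
  | .uni φ => Nat.pair 5 φ.toNat

/-- The language `L∃Uα`: `L∃U` with action modalities `⟨α⟩` for events `α` of an event model. -/
inductive FormA (n : ℕ) : Type where
  | atom : ℕ → FormA n
  | neg : FormA n → FormA n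
  | and : FormA n → FormA n → FormA n
  | box : FormA n → FormA n
  | ex : ℕ → FormA n → FormA n
  | uni : FormA n → FormA n
  | act : Fin n → FormA n → FormA n

/-- Satisfaction for `L∃Uα`, relative to a fixed event model `A`. -/
def SatA {n : ℕ} (A : EventModel n) : (W : Type) → Model W → W → FormA n → Prop
  | _, M, w, .atom p => w ∈ M.val p
  | W, M, w, .neg φ => ¬ SatA A W M w φ
  | W, M, w, .and φ ψ => SatA A W M w φ ∧ SatA A W M w ψ
  | W, M, w, .box φ => ∀ v, M.rel w v → SatA A W M v φ
  | W, M, w, .ex p φ => ∃ X : Set W, SatA A W (M.update p X) w φ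
  | W, M, w, .uni φ => ∀ v, SatA A W M v φ
  | _, M, w, .act β φ => ∃ h : (w, β) ∈ prodDomain M A,
      SatA A (prodDomain M A) (prodModel M A) ⟨(w, β), h⟩ φ

/-- The set of points reachable from `ω` in at most `k` steps along `R`. -/
def reachWithin {W : Type} (M : Model W) (ω : W) : ℕ → Set W
  | 0 => {ω}
  | k + 1 => reachWithin M ω k ∪ {v | ∃ u ∈ reachWithin M ω k, M.rel u v}

theorem mem_reachWithin_self {W : Type} (M : Model W) (ω : W) (k : ℕ) :
    ω ∈ reachWithin M ω k := by
  induction k with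
  | zero => exact rfl
  | succ k ih => exact Or.inl ih

/-- `M^k_ω`: the submodel of `M` generated by going at most `k` steps along `R` from `ω`. -/
def Model.genSub {W : Type} (M : Model W) (ω : W) (k : ℕ) : Model (reachWithin M ω k) :=
  M.restrict (reachWithin M ω k)

/-- `φ ∈ L∃U` has degree `k`. -/
def HasDegreeForm (φ : Form) (k : ℕ) : Prop :=
  ∀ (W : Type) (M : Model W) (ω : W),
    Sat M ω φ ↔ Sat (M.genSub ω k) ⟨ω, mem_reachWithin_self M ω k⟩ φ

/-- `φ ∈ L∃Uα` has degree `k`. -/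
def HasDegreeA {n : ℕ} (A : EventModel n) (φ : FormA n) (k : ℕ) : Prop :=
  ∀ (W : Type) (M : Model W) (ω : W),
    SatA A W M ω φ ↔
      SatA A (reachWithin M ω k) (M.genSub ω k) ⟨ω, mem_reachWithin_self M ω k⟩ φ

/-- `deg(φ)` for `φ ∈ L∃U` (the least degree; `sInf ∅ = 0` by convention). -/
noncomputable def degForm (φ : Form) : ℕ := sInf {k | HasDegreeForm φ k}

/-- `deg(φ)` for `φ ∈ L∃Uα`. -/
noncomputable def degA {n : ℕ} (A : EventModel n) (φ : FormA n) : ℕ :=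
  sInf {k | HasDegreeA A φ k}

/-- `Z` is a bisimulation between `M` and `M'`. -/
def IsBisim {W W' : Type} (M : Model W) (M' : Model W') (Z : W → W' → Prop) : Prop :=
  ∀ s t, Z s t →
    (∀ p, s ∈ M.val p ↔ t ∈ M'.val p) ∧
    (∀ s₁, M.rel s s₁ → ∃ t₁, M'.rel t t₁ ∧ Z s₁ t₁) ∧
    (∀ t₁, M'.rel t t₁ → ∃ s₁, M.rel s s₁ ∧ Z s₁ t₁)

/-- `φ ∈ L∃U` is bisimulation-invariant. -/
def BisimInvariant (φ : Form) : Prop :=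
  ∀ (W W' : Type) (M : Model W) (M' : Model W') (Z : W → W' → Prop),
    IsBisim M M' Z → ∀ w w', Z w w' → (Sat M w φ ↔ Sat M' w' φ)

/-- The modal fixpoint language `L_μ` (with greatest-fixpoint binders `ν`). -/
inductive Formμ : Type where
  | atom : ℕ → Formμ
  | neg : Formμ → Formμ
  | and : Formμ → Formμ → Formμ
  | box : Formμ → Formμ
  | nu : ℕ → Formμ → Formμ

mutual
/-- All occurrences of `p` are under an even number of negations. -/
def PosIn (p : ℕ) : Formμ → Prop
  | .atom _ => True
  | .neg φ => NegIn p φ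
  | .and φ ψ => PosIn p φ ∧ PosIn p ψ
  | .box φ => PosIn p φ
  | .nu q φ => q = p ∨ PosIn p φ

/-- All occurrences of `p` are under an odd number of negations. -/
def NegIn (p : ℕ) : Formμ → Prop
  | .atom q => q ≠ p
  | .neg φ => PosIn p φ
  | .and φ ψ => NegIn p φ ∧ NegIn p ψ
  | .box φ => NegIn p φ
  | .nu q φ => q = p ∨ NegIn p φ
end

/-- Well-formedness for `L_μ`: in each `νp.φ`, `φ` is positive in `p`. -/
def WFμ : Formμ → Prop
  | .atom _ => True
  | .neg φ => WFμ φ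
  | .and φ ψ => WFμ φ ∧ WFμ ψ
  | .box φ => WFμ φ
  | .nu q φ => PosIn q φ ∧ WFμ φ

/-- Satisfaction for `L_μ`: `⟦νp.φ⟧ = ⋃ {X | ∀ ω ∈ X, M[p ↦ X], ω ⊨ φ}`. -/
def Satμ {W : Type} : Model W → W → Formμ → Prop
  | M, w, .atom p => w ∈ M.val p
  | M, w, .neg φ => ¬ Satμ M w φ
  | M, w, .and φ ψ => Satμ M w φ ∧ Satμ M w ψ
  | M, w, .box φ => ∀ v, M.rel w v → Satμ M v φ
  | M, w, .nu q φ => w ∈ ⋃₀ {X : Set W | ∀ v ∈ X, Satμ (M.update q X) v φ}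

/-- An event model with preconditions in `L_μ`. -/
structure EventModelμ (n : ℕ) where
  E : Fin n → Fin n → Prop
  pre : Fin n → Formμ

/-- The domain of the product update `M ⊗ A` for `L_μ` event models. -/
def prodDomainμ {W : Type} (M : Model W) {n : ℕ} (A : EventModelμ n) : Set (W × Fin n) :=
  {x | Satμ M x.1 (A.pre x.2)}

/-- The product update `M ⊗ A` for `L_μ` event models. -/
def prodModelμ {W : Type} (M : Model W) {n : ℕ} (A : EventModelμ n) :
    Model (prodDomainμ M A) :=
  ⟨fun x y => M.rel x.1.1 y.1.1 ∧ A.E x.1.2 y.1.2, fun p => {x | x.1.1 ∈ M.val p}⟩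

/-- Satisfaction depends only on the letters occurring in the formula. -/
theorem sat_congr {W : Type} (φ : Form) : ∀ (M N : Model W), M.rel = N.rel →
    (∀ p, φ.Occurs p → M.val p = N.val p) → ∀ w, Sat M w φ ↔ Sat N w φ := by
  induction φ with
  | atom q => intro M N _ h w; simp only [Sat, h q rfl]
  | neg φ ih => intro M N hr h w; simp only [Sat, ih M N hr h w]
  | and φ ψ ih₁ ih₂ =>
    intro M N hr h w
    simp only [Sat, ih₁ M N hr (fun p hp => h p (Or.inl hp)) w,
      ih₂ M N hr (fun p hp => h p (Or.inr hp)) w]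
  | box φ ih => intro M N hr h w; simp only [Sat, hr, ih M N hr h]
  | ex q φ ih =>
    intro M N hr h w
    refine exists_congr fun X => ih (M.update q X) (N.update q X) hr (fun p hp => ?_) w
    simp only [Model.update, h p (Or.inr hp)]
  | uni φ ih => intro M N hr h w; simp only [Sat, ih M N hr h]

theorem Form.exists_occurs_lt (φ : Form) : ∃ k, ∀ p, φ.Occurs p → p < k := by
  induction φ with
  | atom q => exact ⟨q + 1, fun p (hp : q = p) => by omega⟩
  | neg φ ih => exact ih
  | box φ ih => exact ih
  | uni φ ih => exact ih
  | and φ ψ ih₁ ih₂ =>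
    obtain ⟨a, ha⟩ := ih₁
    obtain ⟨b, hb⟩ := ih₂
    exact ⟨max a b, fun p hp => hp.elim (fun h => lt_max_of_lt_left (ha p h))
      (fun h => lt_max_of_lt_right (hb p h))⟩
  | ex q φ ih =>
    obtain ⟨a, ha⟩ := ih
    exact ⟨max a (q + 1), fun p hp => hp.elim (fun h => lt_max_of_lt_right (by omega))
      (fun h => lt_max_of_lt_left (ha p h))⟩

theorem FormJ.exists_occurs_lt {n : ℕ} (φ : FormJ n) : ∃ k, ∀ p, φ.Occurs p → p < k := by
  induction φ with
  | atom q => exact ⟨q + 1, fun p (hp : q = p) => by omega⟩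
  | nom i => exact ⟨0, fun p hp => hp.elim⟩
  | neg φ ih => exact ih
  | box φ ih => exact ih
  | uni φ ih => exact ih
  | and φ ψ ih₁ ih₂ =>
    obtain ⟨a, ha⟩ := ih₁
    obtain ⟨b, hb⟩ := ih₂
    exact ⟨max a b, fun p hp => hp.elim (fun h => lt_max_of_lt_left (ha p h))
      (fun h => lt_max_of_lt_right (hb p h))⟩
  | ex q φ ih =>
    obtain ⟨a, ha⟩ := ih
    exact ⟨max a (q + 1), fun p hp => hp.elim (fun h => lt_max_of_lt_right (by omega))
      (fun h => lt_max_of_lt_left (ha p h))⟩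

theorem sat_imp {W : Type} (M : Model W) (w : W) (φ ψ : Form) :
    Sat M w (φ.imp ψ) ↔ (Sat M w φ → Sat M w ψ) := by
  simp only [Form.imp, Sat]
  tauto

theorem exists_sat_iff_const (P : Prop) :
    ∃ χ : Form, ∀ (W : Type) (M : Model W) (w : W), Sat M w χ ↔ P := by
  by_cases hP : P
  · exact ⟨.neg (.and (.atom 0) (.neg (.atom 0))), fun W M w => by simp [Sat, hP]⟩
  · exact ⟨.and (.atom 0) (.neg (.atom 0)), fun W M w => by simp [Sat, hP]⟩

/-- `L∃U` is closed under finite conjunctions. -/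
theorem exists_sat_iff_forall {ι : Type} [Finite ι] (S : ι → Prop) (f : ι → Form) :
    ∃ χ : Form, ∀ (W : Type) (M : Model W) (w : W),
      Sat M w χ ↔ ∀ i, S i → Sat M w (f i) := by
  suffices h : ∀ s : Set ι, s.Finite → ∃ χ : Form, ∀ (W : Type) (M : Model W) (w : W),
      Sat M w χ ↔ ∀ i ∈ s, Sat M w (f i) from h {i | S i} (Set.toFinite _)
  intro s hs
  induction s, hs using Set.Finite.induction_on with
  | empty =>
    obtain ⟨χ, hχ⟩ := exists_sat_iff_const True
    exact ⟨χ, fun W M w => by simp [hχ]⟩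
  | @insert a s _ _ ih =>
    obtain ⟨χ, hχ⟩ := ih
    exact ⟨.and (f a) χ, fun W M w => by simp [Sat, hχ]⟩

/-- Reinterpret the `m` letters `k, …, k + m - 1` according to `X`. -/
def Model.updateRange {W : Type} (M : Model W) (k m : ℕ) (X : ℕ → Set W) : Model W :=
  ⟨M.rel, fun q => if k ≤ q ∧ q < k + m then X q else M.val q⟩

/-- Quantification over a block of `m` consecutive letters starting at `k`. -/
theorem exists_sat_iff_exists_updateRange (k m : ℕ) (φ : Form) :
    ∃ χ : Form, ∀ (W : Type) (M : Model W) (w : W),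
      Sat M w χ ↔ ∃ X : ℕ → Set W, Sat (M.updateRange k m X) w φ := by
  induction m generalizing φ with
  | zero =>
    refine ⟨φ, fun W M w => ?_⟩
    have h : ∀ X, M.updateRange k 0 X = M := fun X => by
      have : ∀ q, ¬ (k ≤ q ∧ q < k + 0) := fun q => by omega
      simp only [Model.updateRange, this, if_false]
    simp only [h, exists_const]
  | succ m ih =>
    obtain ⟨χ, hχ⟩ := ih (.ex (k + m) φ)
    refine ⟨χ, fun W M w => (hχ W M w).trans ?_⟩
    simp only [Sat]
    constructor
    · rintro ⟨X, Y, h⟩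
      refine ⟨fun q => if q = k + m then Y else X q, ?_⟩
      convert h using 1
      simp only [Model.updateRange, Model.update, Model.mk.injEq, true_and]
      funext q
      split_ifs <;> first | rfl | omega
    · rintro ⟨X, h⟩
      refine ⟨X, X (k + m), ?_⟩
      convert h using 1
      simp only [Model.updateRange, Model.update, Model.mk.injEq, true_and]
      funext q
      split_ifs with h₁ h₂ h₃ <;> first | rfl | (subst h₁; rfl) | omega

/-- `K`, a model over the set `D` of pairs, is the product of `M` with `A`, except that at
event `i` the letter `p` is interpreted in `M` by the letter `σ i p` (for letters in `S`). -/
structure IsProductVia {W : Type} {n : ℕ} (A : EventModel n) (σ : Fin n → ℕ → ℕ) (S : ℕ → Prop)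
    (M : Model W) (D : Set (W × Fin n)) (K : Model D) : Prop where
  mem_iff : ∀ w i, (w, i) ∈ D ↔ Sat M w (A.pre i)
  rel_iff : ∀ x y, K.rel x y ↔ M.rel x.1.1 y.1.1 ∧ A.E x.1.2 y.1.2
  val_iff : ∀ p, S p → ∀ x, x ∈ K.val p ↔ x.1.1 ∈ M.val (σ x.1.2 p)

theorem IsProductVia.mono {W : Type} {n : ℕ} {A : EventModel n} {σ : Fin n → ℕ → ℕ}
    {S T : ℕ → Prop} {M : Model W} {D : Set (W × Fin n)} {K : Model D}
    (h : IsProductVia A σ S M D K) (hST : ∀ p, T p → S p) : IsProductVia A σ T M D K :=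
  ⟨h.mem_iff, h.rel_iff, fun p hp => h.val_iff p (hST p hp)⟩

/-- Updating `p` in the product amounts to updating the `n` fresh letters `k + i` in the base. -/
theorem IsProductVia.update {W : Type} {n : ℕ} {A : EventModel n} {σ : Fin n → ℕ → ℕ}
    {S T : ℕ → Prop} {M : Model W} {D : Set (W × Fin n)} {K : Model D} {k p : ℕ}
    (h : IsProductVia A σ S M D K) (hST : ∀ q, T q → S q)
    (hpre : ∀ i q, (A.pre i).Occurs q → q < k) (hσ : ∀ i q, S q → σ i q < k)
    {X : ℕ → Set W} {Y : Set D} (hXY : ∀ x, x ∈ Y ↔ x.1.1 ∈ X (k + x.1.2)) :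
    IsProductVia A (fun i q => if q = p then k + i else σ i q) T (M.updateRange k n X) D
      (K.update p Y) := by
  refine ⟨fun w i => (h.mem_iff w i).trans (sat_congr _ M (M.updateRange k n X) rfl
    (fun q hq => ?_) w), h.rel_iff, fun q hq x => ?_⟩
  · have := hpre i q hq
    exact (if_neg (by omega)).symm
  · by_cases hqp : q = p
    · have hi := x.1.2.isLt
      simp [Model.update, Model.updateRange, hqp, hXY]
    · have := hσ x.1.2 q (hST q hq)
      have hlt : ¬ (k ≤ σ x.1.2 q ∧ σ x.1.2 q < k + n) := by omega
      simp only [Model.update, Model.updateRange, hqp, if_false, if_neg hlt]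
      exact h.val_iff q (hST q hq) x

/-- Translation of a sentence with action nominals, evaluated at event `α` of a product model,
into a formula evaluated in the base model. -/
theorem exists_translation {n : ℕ} (A : EventModel n) (ψ : FormJ n) :
    ∀ (σ : Fin n → ℕ → ℕ) (k : ℕ), (∀ i q, (A.pre i).Occurs q → q < k) →
    (∀ i q, ψ.Occurs q → σ i q < k) → ∀ α : Fin n,
    ∃ χ : Form, ∀ (W : Type) (M : Model W) (D : Set (W × Fin n)) (K : Model D),
      IsProductVia A σ (fun q => ψ.Occurs q) M D K → ∀ (w : W) (h : (w, α) ∈ D),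
        (Sat M w χ ↔ SatJ (fun x : D => x.1.2) K ⟨(w, α), h⟩ ψ) := by
  induction ψ with
  | atom p =>
    intro σ k _ _ α
    exact ⟨.atom (σ α p), fun W M D K hK w h => (hK.val_iff p rfl ⟨(w, α), h⟩).symm⟩
  | nom i =>
    intro σ k _ _ α
    obtain ⟨χ, hχ⟩ := exists_sat_iff_const (α = i)
    exact ⟨χ, fun W M D K _ w h => hχ W M w⟩
  | neg φ ih =>
    intro σ k hpre hσ α
    obtain ⟨χ, hχ⟩ := ih σ k hpre hσ α
    exact ⟨.neg χ, fun W M D K hK w h => not_congr (hχ W M D K hK w h)⟩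
  | and φ ψ ih₁ ih₂ =>
    intro σ k hpre hσ α
    obtain ⟨χ₁, h₁⟩ := ih₁ σ k hpre (fun i q hq => hσ i q (Or.inl hq)) α
    obtain ⟨χ₂, h₂⟩ := ih₂ σ k hpre (fun i q hq => hσ i q (Or.inr hq)) α
    exact ⟨.and χ₁ χ₂, fun W M D K hK w h =>
      and_congr (h₁ W M D K (hK.mono fun q => Or.inl) w h)
        (h₂ W M D K (hK.mono fun q => Or.inr) w h)⟩
  | box φ ih =>
    intro σ k hpre hσ α
    choose χ hχ using ih σ k hpre hσ
    obtain ⟨ξ, hξ⟩ := exists_sat_iff_forall (A.E α) (fun i => .box ((A.pre i).imp (χ i)))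
    refine ⟨ξ, fun W M D K hK w h => (hξ W M w).trans ?_⟩
    simp only [Sat, SatJ, sat_imp, hK.rel_iff]
    constructor
    · rintro H ⟨⟨v, i⟩, hv⟩ ⟨hr, hE⟩
      exact (hχ i W M D K hK v hv).1 (H i hE v hr ((hK.mem_iff v i).1 hv))
    · intro H i hE v hr hv
      have hv' := (hK.mem_iff v i).2 hv
      exact (hχ i W M D K hK v hv').2 (H ⟨(v, i), hv'⟩ ⟨hr, hE⟩)
  | ex p φ ih =>
    intro σ k hpre hσ α
    obtain ⟨χ, hχ⟩ := ih (fun i q => if q = p then k + i else σ i q) (k + n)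
      (fun i q hq => (hpre i q hq).trans_le (Nat.le_add_right k n))
      (fun i q hq => by
        have hi := i.isLt
        have := hσ i q (Or.inr hq)
        split_ifs <;> omega) α
    obtain ⟨ξ, hξ⟩ := exists_sat_iff_exists_updateRange k n χ
    refine ⟨ξ, fun W M D K hK w h => (hξ W M w).trans ?_⟩
    simp only [SatJ]
    constructor
    · rintro ⟨X, hX⟩
      exact ⟨{x | x.1.1 ∈ X (k + x.1.2)}, (hχ W _ D _
        (hK.update (fun q => Or.inr) hpre hσ fun x => Iff.rfl) w h).1 hX⟩
    · rintro ⟨Y, hY⟩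
      refine ⟨fun q => {v | ∃ x ∈ Y, x.1.1 = v ∧ k + x.1.2 = q}, (hχ W _ D _
        (hK.update (fun q => Or.inr) hpre hσ fun x => ?_) w h).2 hY⟩
      constructor
      · exact fun hx => ⟨x, hx, rfl, rfl⟩
      · rintro ⟨y, hy, h₁, h₂⟩
        have : y = x := Subtype.ext (Prod.ext h₁ (Fin.ext (by omega)))
        exact this ▸ hy
  | uni φ ih =>
    intro σ k hpre hσ α
    choose χ hχ using ih σ k hpre hσ
    obtain ⟨ξ, hξ⟩ := exists_sat_iff_forall (fun _ : Fin n => True)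
      (fun i => .uni ((A.pre i).imp (χ i)))
    refine ⟨ξ, fun W M D K hK w h => (hξ W M w).trans ?_⟩
    simp only [Sat, SatJ, sat_imp]
    constructor
    · rintro H ⟨⟨v, i⟩, hv⟩
      exact (hχ i W M D K hK v hv).1 (H i trivial v ((hK.mem_iff v i).1 hv))
    · intro H i _ v hv
      have hv' := (hK.mem_iff v i).2 hv
      exact (hχ i W M D K hK v hv').2 (H ⟨(v, i), hv'⟩)

/-- Elimination of action nominals: for every event `α` and every sentence
`ψ ∈ S∃Uj` there is a formula `χ ∈ L∃U` with `χ ≡ ⟨α⟩ψ` valid: for every model `M` and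
point `ω`, `M, ω ⊨ χ` iff `M, ω ⊨ Pre_α` and `M ⊗ A, (ω, α) ⊨ ψ`. -/
theorem stmt5 (n : ℕ) (hn : 0 < n) (A : EventModel n) (α : Fin n) (ψ : FormJ n) :
    ∃ χ : Form, ∀ (W : Type) (M : Model W) (ω : W),
      Sat M ω χ ↔ SatActJ M A α ω ψ := by
  choose a ha using fun i => (A.pre i).exists_occurs_lt
  obtain ⟨b, hb⟩ := ψ.exists_occurs_lt
  obtain ⟨χ, hχ⟩ := exists_translation A ψ (fun _ q => q) (Finset.univ.sup a + b)
    (fun i q hq => by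
      have h₁ := ha i q hq
      have h₂ := Finset.le_sup (f := a) (Finset.mem_univ i)
      omega)
    (fun _ q hq => by
      have := hb q hq
      omega) α
  refine ⟨.and (A.pre α) χ, fun W M ω => ?_⟩
  have key := hχ W M (prodDomain M A) (prodModel M A)
    ⟨fun _ _ => Iff.rfl, fun _ _ => Iff.rfl, fun _ _ _ => Iff.rfl⟩ ω
  exact ⟨fun h => ⟨h.1, (key h.1).1 h.2⟩, fun ⟨h, hψ⟩ => ⟨h, (key h).2 hψ⟩⟩
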